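/- Let R be the set of eleven rewrite rules on binary trees given in the context. Then the rewrite relation ⇒ induced by R is terminating and confluent, and the reflexive–symmetric–transitive closure of ⇒ equals ≡_3, the congruence generated by the single rule (L_3, R_3). In other words, R is a finite convergent presentation of the 3-comb associative operad CAs_3. -/

import Mathlib

/-- A binary tree: either a leaf or an ordered pair of binary trees. -/
inductive BTree : Type
  | leaf : BTree
  | node : BTree → BTree → BTree
  deriving DecidableEq

namespace BTree

/-- The arity of a binary tree is its number of leaves. -/
def arity : BTree → ℕ
  | leaf => 1
  | node l r => arity l + arity r

/-- The degree of a binary tree is its number of internal nodes. -/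
def degree : BTree → ℕ
  | leaf => 0
  | node l r => degree l + degree r + 1

/-- Grafting `t ∘ᵢ s`: identify the root of `s` with the `i`-th leaf of `t`
(leaves numbered from left to right, starting at `1`). -/
def graft : BTree → ℕ → BTree → BTree
  | leaf, i, s => if i = 1 then s else leaf
  | node l r, i, s =>
      if i ≤ l.arity then node (l.graft i s) r else node l (r.graft (i - l.arity) s)

/-- Simultaneous grafting `s ∘ [r_1, …, r_n]`: graft the `i`-th element of the
list onto the `i`-th leaf of `s`, simultaneously. -/
def multigraft : BTree → List BTree → BTree
  | leaf, rs => rs.headD leaf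
  | node l r, rs => node (l.multigraft (rs.take l.arity)) (r.multigraft (rs.drop l.arity))

/-- The left comb with `γ` internal nodes. -/
def leftComb : ℕ → BTree
  | 0 => leaf
  | γ + 1 => node (leftComb γ) leaf

/-- The right comb with `γ` internal nodes. -/
def rightComb : ℕ → BTree
  | 0 => leaf
  | γ + 1 => node leaf (rightComb γ)

/-- The prefix word of a binary tree, over the alphabet `{0, 2}`:
a left-to-right depth-first traversal writes `2` for each internal node and
`0` for each leaf. -/
def prefixWord : BTree → List ℕ
  | leaf => [0]
  | node l r => 2 :: (prefixWord l ++ prefixWord r)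

/-- The left rank: number of internal nodes on the leftmost branch from the root. -/
def leftRank : BTree → ℕ
  | leaf => 0
  | node l _ => leftRank l + 1

/-- The mirror of a binary tree. -/
def mirror : BTree → BTree
  | leaf => leaf
  | node l r => node (mirror r) (mirror l)

end BTree

/-- One step of the rewrite relation induced by a set of rewrite rules `R`:
`r ∘ᵢ (s ∘ [r_1, …, r_n]) ⇒ r ∘ᵢ (s' ∘ [r_1, …, r_n])` whenever `R s s'`. -/
def Step (R : BTree → BTree → Prop) (t t' : BTree) : Prop :=
  ∃ (s s' r : BTree) (i : ℕ) (rs : List BTree),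
    R s s' ∧ 1 ≤ i ∧ i ≤ r.arity ∧ rs.length = s.arity ∧
    t = r.graft i (s.multigraft rs) ∧ t' = r.graft i (s'.multigraft rs)

/-- The congruence generated by a set of rewrite rules: the reflexive–symmetric–transitive
closure of the induced rewrite relation. -/
def CongrGen (R : BTree → BTree → Prop) : BTree → BTree → Prop :=
  Relation.EqvGen (Step R)

/-- The tree `s` occurs as a subtree of `t`. -/
def Occurs (s t : BTree) : Prop :=
  ∃ (r : BTree) (i : ℕ) (rs : List BTree),
    1 ≤ i ∧ i ≤ r.arity ∧ rs.length = s.arity ∧ t = r.graft i (s.multigraft rs)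

/-- The rewrite relation induced by `R` is terminating: there is no infinite
chain `t_0 ⇒ t_1 ⇒ t_2 ⇒ ⋯`. -/
def Terminating (R : BTree → BTree → Prop) : Prop :=
  ¬ ∃ f : ℕ → BTree, ∀ n, Step R (f n) (f (n + 1))

/-- The rewrite relation induced by `R` is confluent. -/
def Confluent (R : BTree → BTree → Prop) : Prop :=
  ∀ t s₁ s₂, Relation.ReflTransGen (Step R) t s₁ → Relation.ReflTransGen (Step R) t s₂ →
    ∃ t', Relation.ReflTransGen (Step R) s₁ t' ∧ Relation.ReflTransGen (Step R) s₂ t'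

/-- The number of equivalence classes of binary trees of arity `n` under the
equivalence relation `E`. -/
noncomputable def classCount (E : BTree → BTree → Prop) (n : ℕ) : ℕ :=
  Nat.card (Quot fun a b : {t : BTree // t.arity = n} => E a.1 b.1)

/-- The congruence `≡_γ` generated by the single rewrite rule `(L_γ, R_γ)`. -/
def CAsCongr (γ : ℕ) : BTree → BTree → Prop :=
  CongrGen fun s s' => s = BTree.leftComb γ ∧ s' = BTree.rightComb γ

/-- The eleven rewrite rules of the convergent presentation of `CAs₃`,
given by the prefix words of their left and right members. -/
def Rules3 : BTree → BTree → Prop := fun s s' => (s, s') ∈ ([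
  ((.node (.node (.node .leaf .leaf) .leaf) .leaf),
   (.node .leaf (.node .leaf (.node .leaf .leaf)))),
  ((.node (.node .leaf (.node .leaf (.node .leaf .leaf))) .leaf),
   (.node (.node .leaf .leaf) (.node .leaf (.node .leaf .leaf)))),
  ((.node .leaf (.node .leaf (.node (.node .leaf (.node .leaf .leaf)) .leaf))),
   (.node .leaf (.node .leaf (.node .leaf (.node .leaf (.node .leaf .leaf)))))),
  ((.node .leaf (.node (.node .leaf (.node .leaf .leaf)) (.node .leaf .leaf))),
   (.node .leaf (.node .leaf (.node .leaf (.node .leaf (.node .leaf .leaf)))))),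
  ((.node .leaf (.node .leaf (.node (.node .leaf .leaf) (.node .leaf (.node .leaf .leaf))))),
   (.node .leaf (.node .leaf (.node .leaf (.node .leaf (.node (.node .leaf .leaf) .leaf)))))),
  ((.node .leaf (.node (.node .leaf .leaf) (.node .leaf (.node .leaf (.node .leaf .leaf))))),
   (.node .leaf (.node .leaf (.node .leaf (.node (.node .leaf .leaf) (.node .leaf .leaf)))))),
  ((.node (.node .leaf (.node (.node .leaf .leaf) .leaf)) (.node .leaf (.node .leaf .leaf))),
   (.node (.node .leaf .leaf) (.node .leaf (.node .leaf (.node .leaf (.node .leaf .leaf)))))),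
  ((.node .leaf (.node .leaf (.node .leaf (.node .leaf (.node (.node .leaf .leaf) (.node .leaf .leaf)))))),
   (.node .leaf (.node .leaf (.node .leaf (.node .leaf (.node .leaf (.node (.node .leaf .leaf) .leaf))))))),
  ((.node .leaf (.node .leaf (.node .leaf (.node (.node .leaf .leaf) (.node (.node .leaf .leaf) .leaf))))),
   (.node .leaf (.node .leaf (.node .leaf (.node .leaf (.node .leaf (.node .leaf (.node .leaf .leaf)))))))),
  ((.node (.node .leaf .leaf) (.node .leaf (.node .leaf (.node (.node .leaf .leaf) (.node .leaf .leaf))))),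
   (.node (.node .leaf .leaf) (.node .leaf (.node .leaf (.node .leaf (.node (.node .leaf .leaf) .leaf)))))),
  ((.node (.node .leaf (.node .leaf .leaf)) (.node .leaf (.node .leaf (.node .leaf (.node .leaf .leaf))))),
   (.node (.node .leaf .leaf) (.node .leaf (.node .leaf (.node .leaf (.node (.node .leaf .leaf) .leaf))))))
  ] : List (BTree × BTree))

open Relation

/-- Binary trees whose leaves are variables labelled by natural numbers. -/
inductive VTree : Type
  | var : ℕ → VTree
  | node : VTree → VTree → VTree
  deriving DecidableEq

namespace VTree

/-- Instantiation of the variables by elements of a type with a binary operation. -/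
def eval {M : Type*} [Mul M] (σ : ℕ → M) : VTree → M
  | var i => σ i
  | node l r => l.eval σ * r.eval σ

/-- Instantiation of the variables by binary trees. -/
def inst (σ : ℕ → BTree) : VTree → BTree
  | var i => σ i
  | node l r => .node (l.inst σ) (r.inst σ)

/-- Substitution according to an association list; variables without a binding are
left unchanged. -/
def subst (θ : List (ℕ × VTree)) : VTree → VTree
  | var i => (θ.lookup i).getD (var i)
  | node l r => node (l.subst θ) (r.subst θ)

/-- Renaming of the variables. -/
def rename (f : ℕ → ℕ) : VTree → VTree
  | var i => var (f i)
  | node l r => node (l.rename f) (r.rename f)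

/-- The underlying binary tree. -/
def shape : VTree → BTree
  | var _ => .leaf
  | node l r => .node l.shape r.shape

/-- Number the leaves of a binary tree from left to right, starting at `k`. -/
def label (k : ℕ) : BTree → VTree
  | .leaf => var k
  | .node l r => node (label k l) (label (k + l.arity) r)

/-- The bindings forced by identifying two trees. -/
def unify : VTree → VTree → List (ℕ × VTree)
  | var i, v => [(i, v)]
  | node a b, var j => [(j, node a b)]
  | node a b, node c d => unify a c ++ unify b d

/-- Boolean equality test, suited to evaluation in the kernel. -/
def beq : VTree → VTree → Bool
  | var i, var j => Nat.beq i j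
  | node a b, node c d => (beq a c).and (beq b d)
  | _, _ => false

/-- Does a tree have the shape prescribed by a pattern, up to the values of the variables? -/
def fits : VTree → VTree → Bool
  | var _, _ => true
  | node _ _, var _ => false
  | node a b, node c d => (fits a c).and (fits b d)

/-- Evaluate a tree completely before passing it on; this makes the kernel evaluate
normal forms eagerly. -/
def force {α : Type} : VTree → (VTree → α) → α
  | var i, f => f (var i)
  | node l r, f => force l fun x => force r fun y => f (node x y)

/-- Rewriting at the root by the first applicable rule of a list. -/
def rootStep (t : VTree) : List (VTree × VTree) → Option VTree
  | [] => none
  | (p, q) :: rs =>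
      match fits p t with
      | false => rootStep t rs
      | true =>
        match beq (p.subst (unify p t)) t with
        | false => rootStep t rs
        | true => some (q.subst (unify p t))

/-- Innermost normalization with bounded recursion depth. -/
def normalize (rs : List (VTree × VTree)) : ℕ → VTree → VTree
  | 0, t => t
  | n + 1, t =>
      match t with
      | var i => var i
      | node l r =>
        force (normalize rs n l) fun l' => force (normalize rs n r) fun r' =>
        match rootStep (node l' r') rs with
        | none => node l' r'
        | some u => force u (normalize rs n)

/-- All overlaps of the left member `v` of a rule with an internal node of a tree:
the bindings forced by the overlap, and the tree where `v` is replaced by the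
right member `v'` of the rule. -/
def overlaps (v v' : VTree) : VTree → List (List (ℕ × VTree) × VTree)
  | var _ => []
  | node l r => (unify (node l r) v, v') ::
      ((overlaps v v' l).map (fun c => (c.1, node c.2 r)) ++
        (overlaps v v' r).map (fun c => (c.1, node l c.2)))

theorem inst_rename (σ : ℕ → BTree) (f : ℕ → ℕ) (t : VTree) :
    (t.rename f).inst σ = t.inst (σ ∘ f) := by
  induction t with
  | var i => rfl
  | node l r hl hr => simp [rename, inst, hl, hr]

theorem inst_subst (σ : ℕ → BTree) (θ : List (ℕ × VTree)) (t : VTree) :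
    (t.subst θ).inst σ = t.inst fun i => ((var i).subst θ).inst σ := by
  induction t with
  | var i => rfl
  | node l r hl hr => simp only [subst, inst, hl, hr]

theorem inst_subst_of_forall_mem {σ : ℕ → BTree} {θ : List (ℕ × VTree)}
    (h : ∀ c ∈ θ, σ c.1 = c.2.inst σ) (t : VTree) : (t.subst θ).inst σ = t.inst σ := by
  induction t with
  | var i =>
    induction θ with
    | nil => rfl
    | cons c θ ih =>
      obtain ⟨j, w⟩ := c
      have ih' := ih fun c hc => h c (List.mem_cons_of_mem _ hc)
      by_cases hij : i = j
      · subst hij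
        simpa [subst, List.lookup, inst] using (h (i, w) (by simp)).symm
      · simpa [subst, List.lookup, beq_false_of_ne hij] using ih'
  | node l r hl hr => simp only [subst, inst, hl, hr]

theorem eq_inst_of_mem_unify {σ : ℕ → BTree} :
    ∀ {u v : VTree}, u.inst σ = v.inst σ → ∀ c ∈ unify u v, σ c.1 = c.2.inst σ
  | var i, v, h, c, hc => by
    obtain rfl : c = (i, v) := by simpa [unify] using hc
    exact h
  | node a b, var j, h, c, hc => by
    obtain rfl : c = (j, node a b) := by simpa [unify] using hc
    exact h.symm
  | node a b, node c d, h, e, he => by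
    simp only [inst, BTree.node.injEq] at h
    simp only [unify, List.mem_append] at he
    exact he.elim (eq_inst_of_mem_unify h.1 e) (eq_inst_of_mem_unify h.2 e)

theorem eq_of_beq : ∀ {t u : VTree}, beq t u = true → t = u
  | var i, var j, h => by rw [Nat.eq_of_beq_eq_true h]
  | node a b, node c d, h => by
    simp only [beq, Bool.and_eq_true] at h
    rw [eq_of_beq h.1, eq_of_beq h.2]
  | var _, node _ _, h => by simp [beq] at h
  | node _ _, var _, h => by simp [beq] at h

theorem force_eq {α : Type} (t : VTree) : ∀ f : VTree → α, force t f = f t := by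
  induction t with
  | var i => exact fun f => rfl
  | node l r hl hr => exact fun f => by simp only [force, hl, hr]

theorem rootStep_eq_some {t u : VTree} {rs : List (VTree × VTree)}
    (h : rootStep t rs = some u) :
    ∃ c ∈ rs, ∃ θ, t = c.1.subst θ ∧ u = c.2.subst θ := by
  induction rs with
  | nil => simp [rootStep] at h
  | cons c rs ih =>
    have ih' : rootStep t rs = some u →
        ∃ d ∈ c :: rs, ∃ θ, t = d.1.subst θ ∧ u = d.2.subst θ := fun h' =>
      let ⟨d, hd, hdt⟩ := ih h'
      ⟨d, List.mem_cons_of_mem _ hd, hdt⟩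
    rw [rootStep] at h
    split at h
    · exact ih' h
    · split at h
      · exact ih' h
      · rename_i _ hb
        exact ⟨c, by simp, _, (eq_of_beq hb).symm, by simpa using h.symm⟩

end VTree

namespace BTree

open VTree

theorem one_le_arity (t : BTree) : 1 ≤ t.arity := by
  induction t with
  | leaf => exact le_rfl
  | node l r hl hr => exact le_trans hl (Nat.le_add_right _ _)

theorem multigraft_eq_inst_label (σ : ℕ → BTree) (s : BTree) :
    ∀ (k : ℕ) (rs : List BTree), (∀ i < s.arity, rs.getD i leaf = σ (k + i)) →
      s.multigraft rs = (label k s).inst σ := by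
  induction s with
  | leaf =>
    intro k rs h
    have h0 := h 0 Nat.zero_lt_one
    cases rs <;> simpa [multigraft, label, inst] using h0
  | node l r hl hr =>
    intro k rs h
    simp only [arity] at h
    simp only [multigraft, label, inst, node.injEq]
    constructor
    · refine hl k _ fun i hi => ?_
      rw [← h i (by omega)]
      simp [List.getD_eq_getElem?_getD, hi]
    · refine hr (k + l.arity) _ fun i hi => ?_
      rw [add_assoc, ← h (l.arity + i) (by omega)]
      simp [List.getD_eq_getElem?_getD, List.getElem?_drop]

/-- Lexicographic comparison of the prefix words of two binary trees. -/
def Lt : BTree → BTree → Prop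
  | _, leaf => False
  | leaf, node _ _ => True
  | node a b, node c d => Lt a c ∨ a = c ∧ Lt b d

theorem lt_irrefl (t : BTree) : ¬ Lt t t := by
  induction t with
  | leaf => exact id
  | node l r hl hr => simp [Lt, hl, hr]

theorem Lt.trans : ∀ {s t u : BTree}, Lt s t → Lt t u → Lt s u
  | _, leaf, _, h, _ => by simp [Lt] at h
  | _, node _ _, leaf, _, h => by simp [Lt] at h
  | leaf, node _ _, node _ _, _, _ => trivial
  | node _ _, node _ _, node _ _, h, h' => by
    simp only [Lt] at h h' ⊢
    rcases h with h | ⟨rfl, h⟩ <;> rcases h' with h' | ⟨rfl, h'⟩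
    · exact .inl (h.trans h')
    · exact .inl h
    · exact .inl h'
    · exact .inr ⟨rfl, h.trans h'⟩

theorem lt_node_left (s t : BTree) : Lt s (node s t) := by
  induction s generalizing t with
  | leaf => trivial
  | node l r hl _ => exact .inl (hl r)

theorem finite_setOf_degree_le (n : ℕ) : {t : BTree | t.degree ≤ n}.Finite := by
  induction n with
  | zero =>
    refine (Set.finite_singleton leaf).subset fun t ht => ?_
    cases t with
    | leaf => rfl
    | node l r => simp [degree] at ht
  | succ n ih =>
    refine ((ih.image2 node ih).insert leaf).subset fun t ht => ?_
    cases t with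
    | leaf => exact Set.mem_insert _ _
    | node l r =>
      simp only [degree, Set.mem_ofPred_eq] at ht
      exact Set.mem_insert_of_mem _
        ⟨l, show l.degree ≤ n by omega, r, show r.degree ≤ n by omega, rfl⟩

/-- On trees of fixed degree, `Lt` is well-founded. -/
theorem wellFounded_degree_eq_lt :
    WellFounded fun s t : BTree => s.degree = t.degree ∧ Lt s t := by
  let rank (t : BTree) : ℕ := {u : BTree | u.degree ≤ t.degree ∧ Lt u t}.ncard
  refine Subrelation.wf (r := InvImage (· < ·) rank) ?_ (InvImage.wf rank Nat.lt_wfRel.wf)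
  rintro s t ⟨hd, hst⟩
  refine Set.ncard_lt_ncard (Set.ssubset_iff_of_subset ?_ |>.2 ⟨s, ⟨hd.le, hst⟩, ?_⟩) ?_
  · exact fun u hu => ⟨hd ▸ hu.1, hu.2.trans hst⟩
  · exact fun hs => lt_irrefl s hs.2
  · exact (finite_setOf_degree_le t.degree).subset fun u hu => hu.1

end BTree

/-- The rewrite relation induced by `R`, presented as a closure under contexts. -/
inductive Red (R : BTree → BTree → Prop) : BTree → BTree → Prop
  | root {s s' t t' : BTree} (h : R s s') (σ : ℕ → BTree) (ht : t = (VTree.label 0 s).inst σ)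
      (ht' : t' = (VTree.label 0 s').inst σ) : Red R t t'
  | left {l l' : BTree} (r : BTree) (h : Red R l l') : Red R (.node l r) (.node l' r)
  | right (l : BTree) {r r' : BTree} (h : Red R r r') : Red R (.node l r) (.node l r')

section Red

variable {R : BTree → BTree → Prop}

theorem Red.graft {x y : BTree} (h : Red R x y) (r : BTree) :
    ∀ i, 1 ≤ i → i ≤ r.arity → Red R (r.graft i x) (r.graft i y) := by
  induction r with
  | leaf =>
    intro i h1 h2
    obtain rfl : i = 1 := le_antisymm h2 h1
    simpa [BTree.graft] using h
  | node l r hl hr =>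
    intro i h1 h2
    simp only [BTree.arity] at h2
    by_cases hi : i ≤ l.arity
    · simpa [BTree.graft, hi] using .left r (hl i h1 hi)
    · simpa [BTree.graft, hi] using .right l (hr (i - l.arity) (by omega) (by omega))

theorem Step.left {t t' : BTree} (h : Step R t t') (r : BTree) :
    Step R (.node t r) (.node t' r) := by
  obtain ⟨s, s', c, i, rs, hs, h1, h2, hl, rfl, rfl⟩ := h
  exact ⟨s, s', .node c r, i, rs, hs, h1, by simp only [BTree.arity]; omega, hl,
    by simp [BTree.graft, h2], by simp [BTree.graft, h2]⟩

theorem Step.right {t t' : BTree} (h : Step R t t') (l : BTree) :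
    Step R (.node l t) (.node l t') := by
  obtain ⟨s, s', c, i, rs, hs, h1, h2, hl, rfl, rfl⟩ := h
  have hi : ¬ l.arity + i ≤ l.arity := by omega
  exact ⟨s, s', .node l c, l.arity + i, rs, hs, by omega, by simp only [BTree.arity]; omega, hl,
    by simp [BTree.graft, hi], by simp [BTree.graft, hi]⟩

theorem step_iff_red (hR : ∀ s s', R s s' → s'.arity = s.arity) (t t' : BTree) :
    Step R t t' ↔ Red R t t' := by
  constructor
  · rintro ⟨s, s', r, i, rs, hs, h1, h2, -, rfl, rfl⟩
    refine Red.graft (.root hs (fun i => rs.getD i .leaf) ?_ ?_) r i h1 h2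
    all_goals exact BTree.multigraft_eq_inst_label _ _ 0 rs fun i _ => by rw [zero_add]
  · intro h
    induction h with
    | @root s s' t t' h σ ht ht' =>
      have hσ (i : ℕ) (hi : i < s.arity) :
          ((List.range s.arity).map σ).getD i .leaf = σ (0 + i) := by
        simp [List.getD_eq_getElem?_getD, List.getElem?_range hi]
      refine ⟨s, s', .leaf, 1, (List.range s.arity).map σ, h, le_rfl, le_rfl, by simp, ?_, ?_⟩
      · simp only [BTree.graft, if_true, ht, BTree.multigraft_eq_inst_label σ s 0 _ hσ]
      · rw [← hR s s' h] at hσ ⊢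
        simp only [BTree.graft, if_true, ht', BTree.multigraft_eq_inst_label σ s' 0 _ hσ]
    | left r _ ih => exact ih.left r
    | right l _ ih => exact ih.right l

theorem reflTransGen_red_node {a b c d : BTree} (h : ReflTransGen (Red R) a b)
    (h' : ReflTransGen (Red R) c d) : ReflTransGen (Red R) (.node a c) (.node b d) :=
  (h.lift (fun x => BTree.node x c) fun _ _ => .left c).trans
    (h'.lift (fun x => BTree.node b x) fun _ _ => .right b)

theorem reflTransGen_red_inst {σ σ' : ℕ → BTree} (h : ∀ i, ReflTransGen (Red R) (σ i) (σ' i))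
    (t : VTree) : ReflTransGen (Red R) (t.inst σ) (t.inst σ') := by
  induction t with
  | var i => exact h i
  | node l r hl hr => exact reflTransGen_red_node hl hr

theorem reflTransGen_red_normalize {rs : List (VTree × VTree)}
    (hrs : ∀ c ∈ rs, ∀ σ, Red R (c.1.inst σ) (c.2.inst σ)) (σ : ℕ → BTree) (n : ℕ) :
    ∀ t : VTree, ReflTransGen (Red R) (t.inst σ) ((t.normalize rs n).inst σ) := by
  induction n with
  | zero => exact fun t => .refl
  | succ n ih =>
    rintro (i | ⟨l, r⟩)
    · exact .refl
    · simp only [VTree.normalize, VTree.force_eq]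
      refine (reflTransGen_red_node (ih l) (ih r)).trans ?_
      split
      · exact .refl
      · rename_i u hu
        obtain ⟨c, hc, θ, ht, rfl⟩ := VTree.rootStep_eq_some hu
        refine .head ?_ (ih _)
        have := hrs c hc fun i => ((VTree.var i).subst θ).inst σ
        rwa [← VTree.inst_subst, ← VTree.inst_subst, ← ht] at this

/-- A step from an instance of `u` either takes place inside the values of the variables,
or is an instance of an overlap. -/
theorem red_inst_cases (σ : ℕ → BTree) (u : VTree) {b : BTree} (h : Red R (u.inst σ) b) :
    (∃ σ', (∀ i, ReflTransGen (Red R) (σ i) (σ' i)) ∧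
      ReflTransGen (Red R) b (u.inst σ')) ∨
    ∃ s s', R s s' ∧ ∃ ρ : ℕ → BTree, (∀ i, ρ (2 * i) = σ i) ∧
      ∃ e ∈ VTree.overlaps ((VTree.label 0 s).rename fun i => 2 * i + 1)
        ((VTree.label 0 s').rename fun i => 2 * i + 1) (u.rename fun i => 2 * i),
        (∀ c ∈ e.1, ρ c.1 = c.2.inst ρ) ∧ b = e.2.inst ρ := by
  induction u generalizing b with
  | var j =>
    refine .inl ⟨Function.update σ j b, fun i => ?_, ?_⟩
    · by_cases hij : i = j
      · subst hij
        simpa [VTree.inst] using ReflTransGen.single h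
      · simpa [hij] using ReflTransGen.refl
    · simpa [VTree.inst] using ReflTransGen.refl
  | node l r hl hr =>
    have hren {ρ : ℕ → BTree} (hρ : ∀ i, ρ (2 * i) = σ i) (u : VTree) :
        (u.rename fun i => 2 * i).inst ρ = u.inst σ := by
      rw [VTree.inst_rename]
      exact congrArg (VTree.inst · u) (funext hρ)
    generalize hx : (VTree.node l r).inst σ = x at h
    cases h with
    | @root s s' _ _ hs τ ht hb =>
      let ρ (n : ℕ) : BTree := if n % 2 = 0 then σ (n / 2) else τ (n / 2)
      have hρ (i : ℕ) : ρ (2 * i) = σ i := by simp [ρ]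
      have hρ' : (ρ ∘ fun i => 2 * i + 1) = τ := by
        funext i
        have h1 : (2 * i + 1) % 2 = 1 := by omega
        have h2 : (2 * i + 1) / 2 = i := by omega
        simp [ρ, h1, h2]
      refine .inr ⟨s, s', hs, ρ, hρ, _, List.mem_cons_self, ?_, ?_⟩
      · refine VTree.eq_inst_of_mem_unify ?_
        rw [VTree.inst_rename, hρ', ← ht, ← hx]
        exact hren hρ (.node l r)
      · rw [VTree.inst_rename, hρ', hb]
    | @left a a' c h =>
      simp only [VTree.inst, BTree.node.injEq] at hx
      obtain ⟨rfl, rfl⟩ := hx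
      rcases hl h with ⟨σ', hσ, hb⟩ | ⟨s, s', hs, ρ, hρ, e, he, hc, rfl⟩
      · exact .inl ⟨σ', hσ, reflTransGen_red_node hb (reflTransGen_red_inst hσ r)⟩
      · refine .inr ⟨s, s', hs, ρ, hρ, (e.1, .node e.2 (r.rename fun i => 2 * i)), ?_, hc, ?_⟩
        · exact List.mem_cons_of_mem _ (List.mem_append_left _ (List.mem_map.2 ⟨e, he, rfl⟩))
        · simp only [VTree.inst, hren hρ]
    | @right a c c' h =>
      simp only [VTree.inst, BTree.node.injEq] at hx
      obtain ⟨rfl, rfl⟩ := hx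
      rcases hr h with ⟨σ', hσ, hb⟩ | ⟨s, s', hs, ρ, hρ, e, he, hc, rfl⟩
      · exact .inl ⟨σ', hσ, reflTransGen_red_node (reflTransGen_red_inst hσ l) hb⟩
      · refine .inr ⟨s, s', hs, ρ, hρ, (e.1, .node (l.rename fun i => 2 * i) e.2), ?_, hc, ?_⟩
        · exact List.mem_cons_of_mem _ (List.mem_append_right _ (List.mem_map.2 ⟨e, he, rfl⟩))
        · simp only [VTree.inst, hren hρ]

/-- If every step from an instance of a left member is joinable with the corresponding root
step, then the relation is locally confluent. -/
theorem join_of_red_of_red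
    (hroot : ∀ s s' σ b, R s s' → Red R ((VTree.label 0 s).inst σ) b →
      Join (ReflTransGen (Red R)) ((VTree.label 0 s').inst σ) b)
    {t a b : BTree} (ha : Red R t a) (hb : Red R t b) : Join (ReflTransGen (Red R)) a b := by
  induction ha generalizing b with
  | root h σ ht ha =>
    subst ht ha
    exact hroot _ _ σ b h hb
  | @left l l' r h ih =>
    cases hb with
    | root h' σ ht hb =>
      subst hb
      exact Join.symm.symm _ _ (hroot _ _ σ _ h' (ht ▸ .left r h))
    | left _ h' =>
      obtain ⟨c, hc, hc'⟩ := ih h'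
      exact ⟨.node c r, reflTransGen_red_node hc .refl, reflTransGen_red_node hc' .refl⟩
    | right _ h' => exact ⟨_, .single (.right _ h'), .single (.left _ h)⟩
  | @right l r r' h ih =>
    cases hb with
    | root h' σ ht hb =>
      subst hb
      exact Join.symm.symm _ _ (hroot _ _ σ _ h' (ht ▸ .right l h))
    | right _ h' =>
      obtain ⟨c, hc, hc'⟩ := ih h'
      exact ⟨.node l c, reflTransGen_red_node .refl hc, reflTransGen_red_node .refl hc'⟩
    | left _ h' => exact ⟨_, .single (.left _ h'), .single (.right _ h)⟩

theorem red_congr {E : Setoid BTree}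
    (hnode : ∀ a b c d, E a b → E c d → E (.node a c) (.node b d))
    (hR : ∀ s s', R s s' → ∀ σ, E ((VTree.label 0 s).inst σ) ((VTree.label 0 s').inst σ))
    {t t' : BTree} (h : Red R t t') : E t t' := by
  induction h with
  | root h σ ht ht' =>
    subst ht ht'
    exact hR _ _ h σ
  | left r _ ih => exact hnode _ _ _ _ ih (E.refl r)
  | right l _ ih => exact hnode _ _ _ _ (E.refl l) ih

end Red

/-- Newman's lemma: a terminating, locally confluent relation is confluent. -/
theorem join_of_wellFounded_of_locallyConfluent {α : Type*} {r : α → α → Prop}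
    (wf : WellFounded fun a b => r b a)
    (hloc : ∀ a b c, r a b → r a c → Join (ReflTransGen r) b c) (a : α) :
    ∀ b c, ReflTransGen r a b → ReflTransGen r a c → Join (ReflTransGen r) b c := by
  induction a using wf.induction with
  | h a ih =>
    intro b c hb hc
    rcases hb.cases_head with rfl | ⟨b', hab', hb'⟩
    · exact ⟨c, hc, .refl⟩
    rcases hc.cases_head with rfl | ⟨c', hac', hc'⟩
    · exact ⟨b, .refl, hb⟩
    obtain ⟨d, hbd, hcd⟩ := hloc a b' c' hab' hac'
    obtain ⟨e, hbe, hde⟩ := ih b' hab' b d hb' hbd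
    obtain ⟨f, hef, hcf⟩ := ih c' hac' e c (hcd.trans hde) hc'
    exact ⟨f, hbe.trans hef, hcf⟩

/-- The eleven rules, with leaves numbered from `0`. -/
def labelledRules3 : List (VTree × VTree) := [
  (.node (.node (.node (.var 0) (.var 1)) (.var 2)) (.var 3),
   .node (.var 0) (.node (.var 1) (.node (.var 2) (.var 3)))),
  (.node (.node (.var 0) (.node (.var 1) (.node (.var 2) (.var 3)))) (.var 4),
   .node (.node (.var 0) (.var 1)) (.node (.var 2) (.node (.var 3) (.var 4)))),
  (.node (.var 0) (.node (.var 1) (.node (.node (.var 2) (.node (.var 3) (.var 4))) (.var 5))),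
   .node (.var 0) (.node (.var 1) (.node (.var 2) (.node (.var 3) (.node (.var 4) (.var 5)))))),
  (.node (.var 0) (.node (.node (.var 1) (.node (.var 2) (.var 3))) (.node (.var 4) (.var 5))),
   .node (.var 0) (.node (.var 1) (.node (.var 2) (.node (.var 3) (.node (.var 4) (.var 5)))))),
  (.node (.var 0) (.node (.var 1) (.node (.node (.var 2) (.var 3)) (.node (.var 4) (.node
     (.var 5) (.var 6))))),
   .node (.var 0) (.node (.var 1) (.node (.var 2) (.node (.var 3) (.node (.node (.var 4)
     (.var 5)) (.var 6)))))),
  (.node (.var 0) (.node (.node (.var 1) (.var 2)) (.node (.var 3) (.node (.var 4) (.node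
     (.var 5) (.var 6))))),
   .node (.var 0) (.node (.var 1) (.node (.var 2) (.node (.node (.var 3) (.var 4)) (.node
     (.var 5) (.var 6)))))),
  (.node (.node (.var 0) (.node (.node (.var 1) (.var 2)) (.var 3))) (.node (.var 4) (.node
     (.var 5) (.var 6))),
   .node (.node (.var 0) (.var 1)) (.node (.var 2) (.node (.var 3) (.node (.var 4) (.node
     (.var 5) (.var 6)))))),
  (.node (.var 0) (.node (.var 1) (.node (.var 2) (.node (.var 3) (.node (.node (.var 4)
     (.var 5)) (.node (.var 6) (.var 7)))))),
   .node (.var 0) (.node (.var 1) (.node (.var 2) (.node (.var 3) (.node (.var 4) (.node (.node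
     (.var 5) (.var 6)) (.var 7))))))),
  (.node (.var 0) (.node (.var 1) (.node (.var 2) (.node (.node (.var 3) (.var 4)) (.node (.node
     (.var 5) (.var 6)) (.var 7))))),
   .node (.var 0) (.node (.var 1) (.node (.var 2) (.node (.var 3) (.node (.var 4) (.node (.var 5)
     (.node (.var 6) (.var 7)))))))),
  (.node (.node (.var 0) (.var 1)) (.node (.var 2) (.node (.var 3) (.node (.node (.var 4)
     (.var 5)) (.node (.var 6) (.var 7))))),
   .node (.node (.var 0) (.var 1)) (.node (.var 2) (.node (.var 3) (.node (.var 4) (.node (.node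
     (.var 5) (.var 6)) (.var 7)))))),
  (.node (.node (.var 0) (.node (.var 1) (.var 2))) (.node (.var 3) (.node (.var 4) (.node
     (.var 5) (.node (.var 6) (.var 7))))),
   .node (.node (.var 0) (.var 1)) (.node (.var 2) (.node (.var 3) (.node (.var 4) (.node (.node
     (.var 5) (.var 6)) (.var 7))))))]

theorem mem_labelledRules3 {s s' : BTree} (h : Rules3 s s') :
    (VTree.label 0 s, VTree.label 0 s') ∈ labelledRules3 := by
  simp only [Rules3, List.mem_cons, Prod.mk.injEq, List.not_mem_nil, or_false] at h
  rcases h with ⟨rfl, rfl⟩ | ⟨rfl, rfl⟩ | ⟨rfl, rfl⟩ | ⟨rfl, rfl⟩ | ⟨rfl, rfl⟩ | ⟨rfl, rfl⟩ |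
    ⟨rfl, rfl⟩ | ⟨rfl, rfl⟩ | ⟨rfl, rfl⟩ | ⟨rfl, rfl⟩ | ⟨rfl, rfl⟩ <;> decide

theorem rules3_shape : ∀ c ∈ labelledRules3, Rules3 c.1.shape c.2.shape ∧
    VTree.label 0 c.1.shape = c.1 ∧ VTree.label 0 c.2.shape = c.2 := by
  unfold Rules3
  decide

theorem red_of_mem_labelledRules3 (c : VTree × VTree) (hc : c ∈ labelledRules3) (σ : ℕ → BTree) :
    Red Rules3 (c.1.inst σ) (c.2.inst σ) := by
  obtain ⟨h, h1, h2⟩ := rules3_shape c hc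
  exact .root h σ (by rw [h1]) (by rw [h2])

theorem rules3_arity {s s' : BTree} (h : Rules3 s s') : s'.arity = s.arity := by
  simp only [Rules3, List.mem_cons, Prod.mk.injEq, List.not_mem_nil, or_false] at h
  rcases h with ⟨rfl, rfl⟩ | ⟨rfl, rfl⟩ | ⟨rfl, rfl⟩ | ⟨rfl, rfl⟩ | ⟨rfl, rfl⟩ | ⟨rfl, rfl⟩ |
    ⟨rfl, rfl⟩ | ⟨rfl, rfl⟩ | ⟨rfl, rfl⟩ | ⟨rfl, rfl⟩ | ⟨rfl, rfl⟩ <;> rfl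

/-- All critical pairs of the eleven rules have a common normal form. -/
theorem criticalPairs_normalize_eq :
    (labelledRules3.all fun c => labelledRules3.all fun d =>
      (VTree.overlaps (d.1.rename fun i => 2 * i + 1) (d.2.rename fun i => 2 * i + 1)
        (c.1.rename fun i => 2 * i)).all fun e =>
          VTree.force ((c.2.rename fun i => 2 * i).subst e.1) fun x =>
          VTree.force (e.2.subst e.1) fun y =>
            (x.normalize labelledRules3 50).beq (y.normalize labelledRules3 50)) = true := by
  decide +kernel

theorem join_root_rules3 (s s' : BTree) (σ : ℕ → BTree) (b : BTree) (hs : Rules3 s s')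
    (h : Red Rules3 ((VTree.label 0 s).inst σ) b) :
    Join (ReflTransGen (Red Rules3)) ((VTree.label 0 s').inst σ) b := by
  rcases red_inst_cases σ _ h with ⟨σ', hσ, hb⟩ | ⟨u, u', hu, ρ, hρ, e, he, hc, rfl⟩
  · exact ⟨_, reflTransGen_red_inst hσ _, hb.tail (.root hs σ' rfl rfl)⟩
  · have key := criticalPairs_normalize_eq
    simp only [List.all_eq_true, VTree.force_eq] at key
    have := VTree.eq_of_beq (key _ (mem_labelledRules3 hs) _ (mem_labelledRules3 hu) e he)
    have hx := reflTransGen_red_normalize red_of_mem_labelledRules3 ρ 50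
      (((VTree.label 0 s').rename fun i => 2 * i).subst e.1)
    have hy := reflTransGen_red_normalize red_of_mem_labelledRules3 ρ 50 (e.2.subst e.1)
    rw [VTree.inst_subst_of_forall_mem hc] at hx hy
    have hσ : (ρ ∘ fun i => 2 * i) = σ := funext hρ
    rw [VTree.inst_rename, hσ] at hx
    exact ⟨_, this ▸ hx, hy⟩

theorem lt_of_mem_labelledRules3 (σ : ℕ → BTree) : ∀ c ∈ labelledRules3,
    (c.2.inst σ).degree = (c.1.inst σ).degree ∧ BTree.Lt (c.2.inst σ) (c.1.inst σ) := by
  have h2 (x y z : BTree) : BTree.Lt x (.node (.node x y) z) :=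
    (BTree.lt_node_left _ _).trans (BTree.lt_node_left _ _)
  simp only [labelledRules3, List.forall_mem_cons, List.not_mem_nil, VTree.inst]
  simp [BTree.Lt, BTree.degree, BTree.lt_node_left, BTree.lt_irrefl, h2]
  omega

theorem red_rules3_lt {t t' : BTree} (h : Red Rules3 t t') :
    t'.degree = t.degree ∧ BTree.Lt t' t := by
  induction h with
  | root h σ ht ht' =>
    subst ht ht'
    exact lt_of_mem_labelledRules3 σ _ (mem_labelledRules3 h)
  | left r _ ih => exact ⟨by simp [BTree.degree, ih.1], .inl ih.2⟩
  | right l _ ih => exact ⟨by simp [BTree.degree, ih.1], .inr ⟨rfl, ih.2⟩⟩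

theorem wellFounded_red_rules3 : WellFounded fun a b => Red Rules3 b a :=
  Subrelation.wf red_rules3_lt BTree.wellFounded_degree_eq_lt

/-- The eleven rules are consequences of the first one. -/
theorem eval_eq_of_mem_labelledRules3 {M : Type*} [Mul M]
    (h : ∀ a b c d : M, ((a * b) * c) * d = a * (b * (c * d))) (σ : ℕ → M) :
    ∀ c ∈ labelledRules3, c.1.eval σ = c.2.eval σ := by
  have h2 (a b c d e : M) :
      (a * (b * (c * d))) * e =
        (a * b) * (c * (d * e)) := by
    rw [← h a b c d, h (a * b) c d e]
  have h3 (a b c d e f : M) :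
      a * (b * ((c * (d * e)) * f)) =
        a * (b * (c * (d * (e * f)))) := by
    rw [← h a b (c * (d * e)) f, h2 (a * b) c d e f, h a b c (d * (e * f))]
  have h4 (a b c d e f : M) :
      a * ((b * (c * d)) * (e * f)) =
        a * (b * (c * (d * (e * f)))) := by
    rw [← h a (b * (c * d)) e f, h2 a b c d e, h a b (c * (d * e)) f, h3 a b c d e f]
  have h5 (a b c d e f g : M) :
      a * (b * ((c * d) * (e * (f * g)))) =
        a * (b * (c * (d * ((e * f) * g)))) := by
    rw [← h3 a b (c * d) e f g, h c d (e * f) g]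
  have h6 (a b c d e f g : M) :
      a * ((b * c) * (d * (e * (f * g)))) =
        a * (b * (c * ((d * e) * (f * g)))) := by
    rw [← h4 a (b * c) d e f g, h b c (d * e) (f * g)]
  have h7 (a b c d e f g : M) :
      (a * ((b * c) * d)) * (e * (f * g)) =
        (a * b) * (c * (d * (e * (f * g)))) := by
    rw [← h2 a ((b * c) * d) e f g, h b c d (e * f), h2 a b c (d * (e * f)) g,
      h3 (a * b) c d e f g]
  have h8 (a b c d e f g k : M) :
      a * (b * (c * (d * ((e * f) * (g * k))))) =
        a * (b * (c * (d * (e * ((f * g) * k))))) := by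
    rw [← h5 a b c d e f (g * k), ← h4 a b (c * d) e f (g * k), h7 b c d e f g k,
      h6 a b c d e f (g * k), h5 b c d e f g k]
  have h9 (a b c d e f g k : M) :
      a * (b * (c * ((d * e) * ((f * g) * k)))) =
        a * (b * (c * (d * (e * (f * (g * k)))))) := by
    rw [← h5 a b c (d * e) f g k, h3 a b c d e (f * (g * k))]
  have h10 (a b c d e f g k : M) :
      (a * b) * (c * (d * ((e * f) * (g * k)))) =
        (a * b) * (c * (d * (e * ((f * g) * k)))) := by
    rw [← h d (e * f) g k, ← h2 a b c ((d * (e * f)) * g) k, h3 b c d e f g,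
      h2 a b c (d * (e * (f * g))) k, h3 (a * b) c d e (f * g) k]
  have h11 (a b c d e f g k : M) :
      (a * (b * c)) * (d * (e * (f * (g * k)))) =
        (a * b) * (c * (d * (e * ((f * g) * k)))) := by
    rw [← h2 a (b * c) d e (f * (g * k)), h7 a b c (d * e) f g k, h5 (a * b) c d e f g k]
  simp only [labelledRules3, List.forall_mem_cons, List.not_mem_nil, VTree.eval]
  exact ⟨h _ _ _ _, h2 _ _ _ _ _, h3 _ _ _ _ _ _, h4 _ _ _ _ _ _, h5 _ _ _ _ _ _ _,
    h6 _ _ _ _ _ _ _, h7 _ _ _ _ _ _ _, h8 _ _ _ _ _ _ _ _, h9 _ _ _ _ _ _ _ _,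
    h10 _ _ _ _ _ _ _ _, h11 _ _ _ _ _ _ _ _, by simp⟩

theorem casCongr_node {a b c d : BTree} {γ : ℕ} (h : CAsCongr γ a b) (h' : CAsCongr γ c d) :
    CAsCongr γ (.node a c) (.node b d) := by
  refine EqvGen.trans _ (.node b c) _ ?_ ?_
  · induction h with
    | rel _ _ h => exact .rel _ _ (h.left c)
    | refl _ => exact .refl _
    | symm _ _ _ ih => exact .symm _ _ ih
    | trans _ _ _ _ _ ih ih' => exact .trans _ _ _ ih ih'
  · induction h' with
    | rel _ _ h => exact .rel _ _ (h.right b)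
    | refl _ => exact .refl _
    | symm _ _ _ ih => exact .symm _ _ ih
    | trans _ _ _ _ _ ih ih' => exact .trans _ _ _ ih ih'

theorem casCongr_three_comb (a b c d : BTree) :
    CAsCongr 3 (.node (.node (.node a b) c) d) (.node a (.node b (.node c d))) :=
  .rel _ _ ⟨_, _, .leaf, 1, [a, b, c, d], ⟨rfl, rfl⟩, le_rfl, le_rfl, rfl, rfl, rfl⟩

theorem casCongr_three_of_rules3 {s s' : BTree} (h : Rules3 s s') (σ : ℕ → BTree) :
    CAsCongr 3 ((VTree.label 0 s).inst σ) ((VTree.label 0 s').inst σ) := by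
  let E : Setoid BTree := ⟨CAsCongr 3, EqvGen.is_equivalence _⟩
  let _ : Mul (Quotient E) := ⟨Quotient.map₂ .node fun _ _ h _ _ h' => casCongr_node h h'⟩
  have heval (t : VTree) : t.eval (fun i => (⟦σ i⟧ : Quotient E)) = ⟦t.inst σ⟧ := by
    induction t with
    | var i => rfl
    | node l r hl hr =>
      rw [VTree.eval, hl, hr]
      rfl
  have hlaw (a b c d : Quotient E) : ((a * b) * c) * d = a * (b * (c * d)) := by
    induction a, b using Quotient.inductionOn₂ with
    | h a b =>
      induction c, d using Quotient.inductionOn₂ with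
      | h c d => exact Quotient.sound (casCongr_three_comb a b c d)
  have := eval_eq_of_mem_labelledRules3 hlaw (fun i => (⟦σ i⟧ : Quotient E)) _
    (mem_labelledRules3 h)
  rw [heval, heval] at this
  exact Quotient.exact this

/-- The eleven rewrite rules form a finite convergent presentation of `CAs₃`:
the induced rewrite relation is terminating and confluent, and the congruence
it generates is `≡₃`. -/
theorem stmt8 :
    Terminating Rules3 ∧ Confluent Rules3 ∧
      (∀ t t' : BTree, CongrGen Rules3 t t' ↔ CAsCongr 3 t t') := by
  have hstep (t t' : BTree) : Step Rules3 t t' ↔ Red Rules3 t t' :=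
    step_iff_red (fun _ _ => rules3_arity) t t'
  refine ⟨?_, ?_, fun t t' => ⟨fun h => ?_, fun h => ?_⟩⟩
  · rintro ⟨f, hf⟩
    exact (wellFounded_iff_isEmpty_descending_chain.1 wellFounded_red_rules3).elim
      ⟨f, fun n => (hstep _ _).1 (hf n)⟩
  · rw [Confluent, show Step Rules3 = Red Rules3 from funext₂ fun t t' => propext (hstep t t')]
    exact join_of_wellFounded_of_locallyConfluent wellFounded_red_rules3
      fun _ _ _ => join_of_red_of_red join_root_rules3
  · let E : Setoid BTree := ⟨CAsCongr 3, EqvGen.is_equivalence _⟩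
    induction h with
    | rel _ _ h =>
      exact red_congr (E := E) (fun _ _ _ _ => casCongr_node)
        (fun _ _ => casCongr_three_of_rules3) ((hstep _ _).1 h)
    | refl _ => exact .refl _
    | symm _ _ _ ih => exact .symm _ _ ih
    | trans _ _ _ _ _ ih ih' => exact .trans _ _ _ ih ih'
  · refine EqvGen.mono ?_ _ _ h
    rintro a b ⟨s, s', r, i, rs, ⟨rfl, rfl⟩, h⟩
    exact ⟨_, _, r, i, rs, List.mem_cons_self, h⟩
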